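/- (Tail Area Influence Function of the Procrustes statistic, core of Proposition 1.) Let g ≥ 1 be a natural number, μ ∈ ℝ, σ > 0, x ∈ ℝ, t ∈ ℝ, and for ε ∈ [0,1] let F_ε = (1−ε)·Φ_{μ,σ} + ε·δ_x. Then the function h(ε) = P_{F_ε^{⊗g}}( Σ_{i=1}^g ((Z_i−μ)/σ)² > t ), giving the tail probability of the sum of the g squared standardized i.i.d. coordinates under the contaminated model, is differentiable at ε = 0 with h′(0) = g·P( χ²_{g−1} > t − ((x−μ)/σ)² ) − g·P( χ²_g > t ). -/

import Mathlib

open MeasureTheory ProbabilityTheory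

/-- The chi-square distribution with `m` degrees of freedom, i.e. the gamma distribution with
shape `m/2` and rate `1/2`, with the convention that `χ²₀` is the Dirac mass at `0`. -/
noncomputable def chiSqMeasure (m : ℕ) : Measure ℝ :=
  if m = 0 then Measure.dirac 0 else gammaMeasure ((m : ℝ) / 2) (1 / 2)

lemma mgf_id_gammaMeasure {a r t : ℝ} (ha : 0 < a) (hr : 0 < r) (ht : t < r) :
    mgf id (gammaMeasure a r) t = r ^ a * (1 / (r - t)) ^ a := by
  have h_nonneg := gammaPDFReal_nonneg ha hr
  have h_meas : Measurable (gammaPDF a r) := (measurable_gammaPDFReal a r).ennreal_ofReal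
  rw [mgf, gammaMeasure, integral_withDensity_eq_integral_toReal_smul h_meas
    (by simp [gammaPDF])]
  have h_eq : (fun x => (gammaPDF a r x).toReal • Real.exp (t * id x)) =
      (Set.Ici (0 : ℝ)).indicator
        fun x => r ^ a / Real.Gamma a * (x ^ (a - 1) * Real.exp (-((r - t) * x))) := by
    ext x
    rw [gammaPDF, ENNReal.toReal_ofReal (h_nonneg x)]
    by_cases hx : 0 ≤ x
    · rw [Set.indicator_of_mem (by simpa using hx), gammaPDFReal, if_pos hx, smul_eq_mul, id,
        show -((r - t) * x) = -(r * x) + t * x by ring, Real.exp_add]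
      ring
    · rw [Set.indicator_of_notMem (by simpa using hx), gammaPDFReal, if_neg hx, zero_smul]
  rw [h_eq, integral_indicator measurableSet_Ici, integral_Ici_eq_integral_Ioi,
    integral_const_mul, Real.integral_rpow_mul_exp_neg_mul_Ioi ha (sub_pos.2 ht)]
  have := (Real.Gamma_pos_of_pos ha).ne'
  field_simp

open Complex in
lemma charFun_gammaMeasure {a r : ℝ} (ha : 0 < a) (hr : 0 < r) (s : ℝ) :
    charFun (gammaMeasure a r) s = (r : ℂ) ^ (a : ℂ) * (1 / (r - s * I)) ^ (a : ℂ) := by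
  have := isProbabilityMeasure_gammaMeasure ha hr
  have h_sub : Set.Iio r ⊆ integrableExpSet id (gammaMeasure a r) := by
    intro t ht
    rw [integrableExpSet, Set.mem_ofPred_eq, ← mgf_pos_iff, mgf_id_gammaMeasure ha hr ht]
    have : 0 < r - t := sub_pos.2 ht
    positivity
  have h_int : Set.Iio r ⊆ interior (integrableExpSet id (gammaMeasure a r)) :=
    interior_maximal h_sub isOpen_Iio
  have h_open : IsOpen {z : ℂ | z.re < r} := isOpen_lt continuous_re continuous_const
  have h_left : AnalyticOnNhd ℂ (complexMGF id (gammaMeasure a r)) {z | z.re < r} :=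
    analyticOnNhd_complexMGF.mono fun z hz => h_int hz
  have h_right : AnalyticOnNhd ℂ (fun z : ℂ => (r : ℂ) ^ (a : ℂ) * (1 / (r - z)) ^ (a : ℂ))
      {z | z.re < r} := by
    refine DifferentiableOn.analyticOnNhd (fun z hz => ?_) h_open
    have hz' : 0 < (r - z).re := by simpa using hz
    have hne : (r : ℂ) - z ≠ 0 := fun h => by simp [h] at hz'
    have h_slit : 1 / ((r : ℂ) - z) ∈ slitPlane := by
      left
      rw [one_div, inv_re]
      exact div_pos hz' (normSq_pos.2 hne)
    refine DifferentiableAt.differentiableWithinAt ?_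
    have h_inv : DifferentiableAt ℂ (fun z : ℂ => 1 / ((r : ℂ) - z)) z :=
      (differentiableAt_const _).div ((differentiableAt_const _).sub differentiableAt_id) hne
    exact (h_inv.cpow (differentiableAt_const _) h_slit).const_mul _
  have h_eq := AnalyticOnNhd.eqOn_of_preconnected_of_frequently_eq h_left h_right
    (convex_halfSpace_re_lt r).isPreconnected (z₀ := ((0 : ℝ) : ℂ)) (by simpa using hr) ?_
  · rw [← complexMGF_id_mul_I]
    exact h_eq (by simpa using hr)
  have h_real : ∀ᶠ t : ℝ in nhdsWithin 0 {0}ᶜ, complexMGF id (gammaMeasure a r) t =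
      (r : ℂ) ^ (a : ℂ) * (1 / (r - t)) ^ (a : ℂ) := by
    filter_upwards [nhdsWithin_le_nhds (Iio_mem_nhds hr)] with t ht
    have h_pos : 0 < r - t := sub_pos.2 ht
    rw [complexMGF_ofReal, mgf_id_gammaMeasure ha hr ht, ofReal_mul, ofReal_cpow hr.le,
      ofReal_cpow (by positivity)]
    push_cast
    rfl
  suffices h_tendsto : Filter.Tendsto (fun t : ℝ => (t : ℂ)) (nhdsWithin 0 {0}ᶜ)
      (nhdsWithin ((0 : ℝ) : ℂ) {((0 : ℝ) : ℂ)}ᶜ) from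
    h_tendsto.frequently h_real.frequently
  refine tendsto_nhdsWithin_iff.2 ⟨?_, ?_⟩
  · exact (continuous_ofReal.tendsto 0).mono_left nhdsWithin_le_nhds
  · filter_upwards [self_mem_nhdsWithin] with t ht
    simpa using ht

open Complex in
lemma charFun_chiSqMeasure (m : ℕ) (s : ℝ) :
    charFun (chiSqMeasure m) s =
      ((1 / 2 : ℂ) ^ (1 / 2 : ℂ) * (1 / (1 / 2 - s * I)) ^ (1 / 2 : ℂ)) ^ m := by
  rcases eq_or_ne m 0 with rfl | hm
  · simp [chiSqMeasure]
  rw [chiSqMeasure, if_neg hm, charFun_gammaMeasure (by positivity) (by norm_num), mul_pow,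
    ← cpow_nat_mul, ← cpow_nat_mul]
  push_cast
  ring_nf

instance (m : ℕ) : IsProbabilityMeasure (chiSqMeasure m) := by
  rcases eq_or_ne m 0 with rfl | hm
  · rw [chiSqMeasure, if_pos rfl]
    infer_instance
  · rw [chiSqMeasure, if_neg hm]
    exact isProbabilityMeasure_gammaMeasure (by positivity) (by norm_num)

open Complex in
lemma ofReal_mul_cpow {r : ℝ} (hr : 0 < r) {w : ℂ} (hw : w ≠ 0) (a : ℂ) :
    ((r : ℂ) * w) ^ a = (r : ℂ) ^ a * w ^ a := by
  have hr' : (r : ℂ) ≠ 0 := ofReal_ne_zero.2 hr.ne'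
  rw [cpow_def_of_ne_zero (mul_ne_zero hr' hw), cpow_def_of_ne_zero hr', cpow_def_of_ne_zero hw,
    log_ofReal_mul hr hw, ofReal_log hr.le, add_mul, Complex.exp_add]

open Complex in
lemma integral_cexp_sq_gaussianReal (s : ℝ) :
    ∫ z : ℝ, cexp (s * ((z ^ 2 : ℝ) : ℂ) * I) ∂(gaussianReal 0 1) =
      (1 / 2 : ℂ) ^ (1 / 2 : ℂ) * (1 / (1 / 2 - s * I)) ^ (1 / 2 : ℂ) := by
  rw [integral_gaussianReal_eq_integral_smul one_ne_zero]
  have h_eq (z : ℝ) : gaussianPDFReal 0 1 z • cexp (s * ((z ^ 2 : ℝ) : ℂ) * I) =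
      ((√(2 * Real.pi))⁻¹ : ℝ) * cexp (-(1 / 2 - s * I) * (z : ℂ) ^ 2) := by
    rw [gaussianPDFReal, real_smul, ofReal_mul, mul_assoc, ofReal_exp, ← Complex.exp_add]
    congr 2
    · simp
    · push_cast
      ring
  simp_rw [h_eq]
  rw [integral_const_mul, integral_gaussian_complex (by simp), div_eq_mul_one_div,
    ofReal_mul_cpow Real.pi_pos (one_div_ne_zero fun h => by simpa using congrArg re h),
    ← mul_assoc]
  · congr 1
    rw [show (1 / 2 : ℂ) = ((1 / 2 : ℝ) : ℂ) by push_cast; rfl, ← ofReal_cpow Real.pi_pos.le,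
      ← ofReal_cpow (by norm_num), ← ofReal_mul, ← Real.sqrt_eq_rpow, ← Real.sqrt_eq_rpow,
      Real.sqrt_mul zero_le_two, Real.sqrt_div zero_le_one, Real.sqrt_one]
    have := (Real.sqrt_pos.2 Real.pi_pos).ne'
    congr 1
    field_simp

lemma gaussianReal_map_standardize (μ : ℝ) {σ : ℝ} (hσ : 0 < σ)
    {v : NNReal} (hv : (v : ℝ) = σ ^ 2) :
    (gaussianReal μ v).map (fun z => (z - μ) / σ) = gaussianReal 0 1 := by
  rw [show (fun z => (z - μ) / σ) = (· / σ) ∘ (· - μ) from rfl,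
    ← Measure.map_map (by fun_prop) (by fun_prop), gaussianReal_map_sub_const,
    gaussianReal_map_div_const, sub_self, zero_div]
  congr 1
  ext
  simp [hv, hσ.ne']

open Complex in
lemma integral_cexp_standardized_sq_gaussianReal (μ : ℝ) {σ : ℝ} (hσ : 0 < σ)
    {v : NNReal} (hv : (v : ℝ) = σ ^ 2) (s : ℝ) :
    ∫ z : ℝ, cexp (s * ((((z - μ) / σ) ^ 2 : ℝ) : ℂ) * I)
        ∂(gaussianReal μ v) =
      (1 / 2 : ℂ) ^ (1 / 2 : ℂ) * (1 / (1 / 2 - s * I)) ^ (1 / 2 : ℂ) := by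
  rw [← integral_cexp_sq_gaussianReal, ← gaussianReal_map_standardize μ hσ hv,
    integral_map (by fun_prop) (by fun_prop)]

open Complex in
lemma map_sum_sq_pi_gaussianReal_dirac {ι : Type*} [Fintype ι] [DecidableEq ι] (T : Finset ι)
    (μ x : ℝ) {σ : ℝ} (hσ : 0 < σ)
    {v : NNReal} (hv : (v : ℝ) = σ ^ 2) :
    (Measure.pi fun i => if i ∈ T then Measure.dirac x
        else gaussianReal μ v).map (fun z => ∑ i, ((z i - μ) / σ) ^ 2) =
      (chiSqMeasure (Fintype.card ι - T.card)).map (· + T.card * ((x - μ) / σ) ^ 2) := by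
  have h_prob (i : ι) : IsProbabilityMeasure (if i ∈ T then Measure.dirac x
      else gaussianReal μ v) := by
    split_ifs <;> infer_instance
  have h_meas : Measurable fun z : ι → ℝ => ∑ i, ((z i - μ) / σ) ^ 2 := by fun_prop
  refine Measure.ext_of_charFun (funext fun s => ?_)
  have h_left : charFun ((Measure.pi fun i => if i ∈ T then Measure.dirac x
        else gaussianReal μ v).map (fun z => ∑ i, ((z i - μ) / σ) ^ 2)) s =
      ∏ i, ∫ z : ℝ, cexp (s * ((((z - μ) / σ) ^ 2 : ℝ) : ℂ) * I) ∂(if i ∈ T then Measure.dirac x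
        else gaussianReal μ v) := by
    rw [charFun_apply_real, integral_map h_meas.aemeasurable (by fun_prop),
      ← integral_fintype_prod_eq_prod
        (fun _ (z : ℝ) => cexp (s * ((((z - μ) / σ) ^ 2 : ℝ) : ℂ) * I))]
    congr 1 with z
    rw [← Complex.exp_sum, ofReal_sum, Finset.mul_sum, Finset.sum_mul]
  have h_factor (i : ι) :
      ∫ z : ℝ, cexp (s * ((((z - μ) / σ) ^ 2 : ℝ) : ℂ) * I) ∂(if i ∈ T then Measure.dirac x
        else gaussianReal μ v) =
      if i ∈ T then cexp (s * ((((x - μ) / σ) ^ 2 : ℝ) : ℂ) * I)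
      else (1 / 2 : ℂ) ^ (1 / 2 : ℂ) * (1 / (1 / 2 - s * I)) ^ (1 / 2 : ℂ) := by
    split_ifs
    · rw [integral_dirac]
    · rw [integral_cexp_standardized_sq_gaussianReal μ hσ hv]
  have h_right := charFun_chiSqMeasure (Fintype.card ι - T.card) s
  rw [h_left, Finset.prod_congr rfl fun i _ => h_factor i, charFun_map_add_const, h_right,
    Finset.prod_ite, Finset.prod_const, Finset.prod_const, ← Complex.exp_nat_mul, mul_comm]
  congr 2
  · rw [Finset.filter_not, Finset.card_sdiff_of_subset (Finset.filter_subset _ _)]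
    simp
  · simp
    ring

lemma pi_smul_add_smul {ι α : Type*} [Fintype ι] [DecidableEq ι] [MeasurableSpace α]
    (ν₁ ν₂ : Measure α) [IsFiniteMeasure ν₁] [IsFiniteMeasure ν₂] {a b : ENNReal}
    (ha : a ≠ ⊤) (hb : b ≠ ⊤) :
    (Measure.pi fun _ : ι => a • ν₁ + b • ν₂) =
      ∑ T : Finset ι, (a ^ (Fintype.card ι - T.card) * b ^ T.card) •
        Measure.pi fun i => if i ∈ T then ν₂ else ν₁ := by
  have := ν₁.smul_finite ha
  have := ν₂.smul_finite hb
  have h_fin (T : Finset ι) (i : ι) : IsFiniteMeasure (if i ∈ T then ν₂ else ν₁) := by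
    split_ifs <;> infer_instance
  refine Measure.pi_eq fun s _ => ?_
  simp only [Measure.coe_finsetSum, Finset.sum_apply, Measure.smul_apply, Measure.pi_pi,
    Measure.add_apply, smul_eq_mul]
  simp_rw [add_comm (a * _)]
  rw [Finset.prod_add, Finset.powerset_univ]
  refine Finset.sum_congr rfl fun T _ => ?_
  have h_ite (i : ι) : (if i ∈ T then ν₂ else ν₁) (s i) = if i ∈ T then ν₂ (s i) else ν₁ (s i) := by
    split_ifs <;> rfl
  simp_rw [h_ite]
  rw [Finset.prod_mul_distrib, Finset.prod_mul_distrib, Finset.prod_const, Finset.prod_const,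
    Finset.prod_ite, Finset.card_sdiff_of_subset (Finset.subset_univ _), Finset.card_univ,
    Finset.filter_not, Finset.filter_mem_eq_inter, Finset.univ_inter]
  ring

lemma hasDerivAt_sum_choose_mul_pow (n : ℕ) (c : ℕ → ℝ) :
    HasDerivAt
      (fun ε : ℝ => ∑ k ∈ Finset.range (n + 1),
        n.choose k * ((1 - ε) ^ (n - k) * ε ^ k * c k))
      (n * c 1 - n * c 0) 0 := by
  rcases n with _ | n
  · simpa using hasDerivAt_const (0 : ℝ) (c 0)
  have h_sub : HasDerivAt (fun ε : ℝ => 1 - ε) (-1) 0 := (hasDerivAt_id 0).const_sub 1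
  have h_term (k : ℕ) := (((h_sub.pow (n + 1 - k)).mul ((hasDerivAt_id (0 : ℝ)).pow k)).mul_const
    (c k)).const_mul ((n + 1).choose k : ℝ)
  have h_sum := HasDerivAt.fun_sum (u := Finset.range (n + 1 + 1)) fun k _ => h_term k
  refine h_sum.congr_deriv ?_
  rw [Finset.sum_range_succ', Finset.sum_range_succ']
  simp
  ring

lemma hasDerivWithinAt_tail_contaminated_gaussianReal (g : ℕ) (μ x t : ℝ) {σ : ℝ} (hσ : 0 < σ)
    {v : NNReal} (hv : (v : ℝ) = σ ^ 2) :
    HasDerivWithinAt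
      (fun ε : ℝ =>
        ((Measure.pi fun _ : Fin g =>
            (ENNReal.ofReal (1 - ε) • gaussianReal μ v
              + ENNReal.ofReal ε • Measure.dirac x))
          {z | t < ∑ i, ((z i - μ) / σ) ^ 2}).toReal)
      ((g : ℝ) * ((chiSqMeasure (g - 1)) (Set.Ioi (t - ((x - μ) / σ) ^ 2))).toReal
        - (g : ℝ) * ((chiSqMeasure g) (Set.Ioi t)).toReal)
      (Set.Icc 0 1) 0 := by
  have h_deriv := hasDerivAt_sum_choose_mul_pow g
    fun k => ((chiSqMeasure (g - k)) (Set.Ioi (t - k * ((x - μ) / σ) ^ 2))).toReal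
  simp only [Nat.cast_one, one_mul, Nat.cast_zero, zero_mul, sub_zero, Nat.sub_zero] at h_deriv
  refine h_deriv.hasDerivWithinAt.congr_of_mem (fun ε hε => ?_) (by simp)
  have h_tail (T : Finset (Fin g)) :
      (Measure.pi fun i => if i ∈ T then Measure.dirac x
        else gaussianReal μ v) {z | t < ∑ i, ((z i - μ) / σ) ^ 2} =
      chiSqMeasure (g - T.card) (Set.Ioi (t - T.card * ((x - μ) / σ) ^ 2)) := by
    have h_meas : Measurable fun z : Fin g → ℝ => ∑ i, ((z i - μ) / σ) ^ 2 := by fun_prop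
    have h_law := congrArg (· (Set.Ioi t)) (map_sum_sq_pi_gaussianReal_dirac T μ x hσ hv)
    simp only [Fintype.card_fin] at h_law
    rw [Measure.map_apply h_meas measurableSet_Ioi,
      Measure.map_apply (by fun_prop) measurableSet_Ioi] at h_law
    refine h_law.trans (congrArg _ ?_)
    ext y
    simp [sub_lt_iff_lt_add]
  rw [pi_smul_add_smul _ _ ENNReal.ofReal_ne_top ENNReal.ofReal_ne_top]
  simp only [Measure.coe_finsetSum, Finset.sum_apply, Measure.smul_apply, h_tail, smul_eq_mul,
    Fintype.card_fin]
  rw [ENNReal.toReal_sum fun T _ => by finiteness]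
  simp only [ENNReal.toReal_mul, ENNReal.toReal_pow, ENNReal.toReal_ofReal hε.1,
    ENNReal.toReal_ofReal (sub_nonneg.2 hε.2)]
  rw [← Finset.powerset_univ, Finset.sum_powerset_apply_card
    (fun k => (1 - ε) ^ (g - k) * ε ^ k *
      ((chiSqMeasure (g - k)) (Set.Ioi (t - k * ((x - μ) / σ) ^ 2))).toReal)]
  simp [nsmul_eq_mul]

theorem stmt1 (g : ℕ) (hg : 1 ≤ g) (μ σ x t : ℝ) (hσ : 0 < σ) :
    HasDerivWithinAt
      (fun ε : ℝ =>
        ((Measure.pi fun _ : Fin g =>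
            (ENNReal.ofReal (1 - ε) • gaussianReal μ ⟨σ ^ 2, sq_nonneg σ⟩
              + ENNReal.ofReal ε • Measure.dirac x))
          {z | t < ∑ i, ((z i - μ) / σ) ^ 2}).toReal)
      ((g : ℝ) * ((chiSqMeasure (g - 1)) (Set.Ioi (t - ((x - μ) / σ) ^ 2))).toReal
        - (g : ℝ) * ((chiSqMeasure g) (Set.Ioi t)).toReal)
      (Set.Icc 0 1) 0 := by
  exact hasDerivWithinAt_tail_contaminated_gaussianReal g μ x t hσ rfl
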